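/- Let V be a finite-dimensional complex vector space, 𝔤 ⊆ End_ℂ(V) a complex linear subspace, and a : V × V → 𝔤 an ℝ-bilinear alternating map. Define p₂a(x,y) = ½(a(x,y) + a(ix,iy)), a⁻(x,y) = ½(a(x,y) − a(ix,iy)), p₁a(x,y) = ½(a⁻(x,y) − i·a⁻(ix,y)), and p₃a(x,y) = ½(a⁻(x,y) + i·a⁻(ix,y)). If ∂a = 0, then ∂(p₁a) = 0, ∂(p₂a) = 0 and ∂(p₃a) = 0. -/

import Mathlib

noncomputable section

variable {V : Type*} [AddCommGroup V] [Module ℂ V]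
variable {𝔤 : Submodule ℂ (V →ₗ[ℂ] V)}

/-- The `(0,2)`-type part auxiliary: `a⁻(x,y) = ½(a(x,y) − a(ix,iy))`. -/
def aMinus (a : V →ₗ[ℝ] V →ₗ[ℝ] 𝔤) (x y : V) : 𝔤 :=
  ((1 : ℂ)/2) • (a x y - a (Complex.I • x) (Complex.I • y))

/-- `p₁a(x,y) = ½(a⁻(x,y) − i·a⁻(ix,y))`. -/
def p1 (a : V →ₗ[ℝ] V →ₗ[ℝ] 𝔤) (x y : V) : 𝔤 :=
  ((1 : ℂ)/2) • (aMinus a x y - Complex.I • aMinus a (Complex.I • x) y)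

/-- `p₂a(x,y) = ½(a(x,y) + a(ix,iy))`. -/
def p2 (a : V →ₗ[ℝ] V →ₗ[ℝ] 𝔤) (x y : V) : 𝔤 :=
  ((1 : ℂ)/2) • (a x y + a (Complex.I • x) (Complex.I • y))

/-- `p₃a(x,y) = ½(a⁻(x,y) + i·a⁻(ix,y))`. -/
def p3 (a : V →ₗ[ℝ] V →ₗ[ℝ] 𝔤) (x y : V) : 𝔤 :=
  ((1 : ℂ)/2) • (aMinus a x y + Complex.I • aMinus a (Complex.I • x) y)

theorem bianchi_p1
    (a : V →ₗ[ℝ] V →ₗ[ℝ] 𝔤)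
    (halt : ∀ x y : V, a x y = - a y x)
    (hbianchi : ∀ x y z : V,
      (a x y : V →ₗ[ℂ] V) z + (a y z : V →ₗ[ℂ] V) x + (a z x : V →ₗ[ℂ] V) y = 0)
    (x y z : V) :
    (p1 a x y : V →ₗ[ℂ] V) z + (p1 a y z : V →ₗ[ℂ] V) x + (p1 a z x : V →ₗ[ℂ] V) y = 0 := by
  have hI : Complex.I ^ 2 = -1 := Complex.I_sq
  have hII (v : V) : Complex.I • Complex.I • v = -v := by
    rw [smul_smul, Complex.I_mul_I, neg_one_smul]
  simp only [p1, aMinus, Submodule.coe_smul, Submodule.coe_sub,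
    LinearMap.smul_apply, LinearMap.sub_apply, hII, map_neg,
    LinearMap.neg_apply, Submodule.coe_neg]
  linear_combination (norm := skip)
    (1 / 8 : ℂ) • hbianchi x y z +
    (-Complex.I / 8 : ℂ) • hbianchi (Complex.I • x) y z +
    (-Complex.I / 8 : ℂ) • hbianchi x (Complex.I • y) z +
    (-Complex.I / 8 : ℂ) • hbianchi x y (Complex.I • z) +
    (-1 / 8 : ℂ) • hbianchi (Complex.I • x) (Complex.I • y) z +
    (-1 / 8 : ℂ) • hbianchi (Complex.I • x) y (Complex.I • z) +
    (-1 / 8 : ℂ) • hbianchi x (Complex.I • y) (Complex.I • z) +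
    (Complex.I / 8 : ℂ) • hbianchi (Complex.I • x) (Complex.I • y) (Complex.I • z)
  simp only [map_smul, halt z x, halt (Complex.I • z) x, halt z (Complex.I • x),
    halt (Complex.I • z) (Complex.I • x), Submodule.coe_neg, LinearMap.neg_apply]
  match_scalars <;> grind only

theorem bianchi_p2
    (a : V →ₗ[ℝ] V →ₗ[ℝ] 𝔤)
    (halt : ∀ x y : V, a x y = - a y x)
    (hbianchi : ∀ x y z : V,
      (a x y : V →ₗ[ℂ] V) z + (a y z : V →ₗ[ℂ] V) x + (a z x : V →ₗ[ℂ] V) y = 0)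
    (x y z : V) :
    (p2 a x y : V →ₗ[ℂ] V) z + (p2 a y z : V →ₗ[ℂ] V) x + (p2 a z x : V →ₗ[ℂ] V) y = 0 := by
  have hI : Complex.I ^ 2 = -1 := Complex.I_sq
  simp only [p2, Submodule.coe_smul, Submodule.coe_add,
    LinearMap.smul_apply, LinearMap.add_apply]
  linear_combination (norm := skip)
    (3 / 8 : ℂ) • hbianchi x y z +
    (-Complex.I / 8 : ℂ) • hbianchi (Complex.I • x) y z +
    (-Complex.I / 8 : ℂ) • hbianchi x (Complex.I • y) z +
    (-Complex.I / 8 : ℂ) • hbianchi x y (Complex.I • z) +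
    (1 / 8 : ℂ) • hbianchi (Complex.I • x) (Complex.I • y) z +
    (1 / 8 : ℂ) • hbianchi (Complex.I • x) y (Complex.I • z) +
    (1 / 8 : ℂ) • hbianchi x (Complex.I • y) (Complex.I • z) +
    (-3 * Complex.I / 8 : ℂ) • hbianchi (Complex.I • x) (Complex.I • y) (Complex.I • z)
  simp only [map_smul, halt z x, halt (Complex.I • z) x, halt z (Complex.I • x),
    halt (Complex.I • z) (Complex.I • x), Submodule.coe_neg, LinearMap.neg_apply]
  match_scalars <;> grind only

theorem p3_eq_sub (a : V →ₗ[ℝ] V →ₗ[ℝ] 𝔤) (x y : V) :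
    p3 a x y = a x y - p1 a x y - p2 a x y := by
  simp only [p1, p2, p3, aMinus]
  module

/-- If an `ℝ`-bilinear alternating map `a : V × V → 𝔤` satisfies the first Bianchi
identity `∂a = 0`, then so do its three pieces `p₁a`, `p₂a` and `p₃a`. -/
theorem bianchi_of_parts [FiniteDimensional ℂ V]
    (a : V →ₗ[ℝ] V →ₗ[ℝ] 𝔤)
    (halt : ∀ x y : V, a x y = - a y x)
    (hbianchi : ∀ x y z : V,
      (a x y : V →ₗ[ℂ] V) z + (a y z : V →ₗ[ℂ] V) x + (a z x : V →ₗ[ℂ] V) y = 0) :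
    (∀ x y z : V,
      (p1 a x y : V →ₗ[ℂ] V) z + (p1 a y z : V →ₗ[ℂ] V) x + (p1 a z x : V →ₗ[ℂ] V) y = 0) ∧
    (∀ x y z : V,
      (p2 a x y : V →ₗ[ℂ] V) z + (p2 a y z : V →ₗ[ℂ] V) x + (p2 a z x : V →ₗ[ℂ] V) y = 0) ∧
    (∀ x y z : V,
      (p3 a x y : V →ₗ[ℂ] V) z + (p3 a y z : V →ₗ[ℂ] V) x + (p3 a z x : V →ₗ[ℂ] V) y = 0) := by
  have h1 := bianchi_p1 a halt hbianchi
  have h2 := bianchi_p2 a halt hbianchi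
  refine ⟨h1, h2, fun x y z => ?_⟩
  simp only [p3_eq_sub, Submodule.coe_sub, LinearMap.sub_apply]
  linear_combination (norm := module) hbianchi x y z - h1 x y z - h2 x y z

end
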